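/- Pinching–divergence bound: let ρ and σ be density matrices on ℂ^d, let ℰ_σ be the pinching map with respect to σ, and let ν_σ be the number of distinct eigenvalues of σ. Then for every α ∈ (0, 1/2): Tr[ℰ_σ(ρ)^{1−α} σ^α] ≤ ν_σ^α · Tr[(σ^{α/(2(1−α))} ρ σ^{α/(2(1−α))})^{1−α}]; equivalently, Tr[ℰ_σ(ρ)^{1−α} σ^α] ≤ ν_σ^α · 2^{−α D̃_{1−α}(ρ‖σ)}. -/

import Mathlib

open Matrix BigOperators
open scoped ComplexOrder

noncomputable section

variable {n : Type*} [Fintype n] [DecidableEq n]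

/-- Real power with the convention `0 ^ r = 0`. -/
def rpow0 (x r : ℝ) : ℝ := if x = 0 then 0 else Real.rpow x r

/-- Matrix power by the spectral functional calculus (with `0 ^ r = 0` on the kernel),
for Hermitian matrices; junk value `0` otherwise. -/
def matPow (M : Matrix n n ℂ) (r : ℝ) : Matrix n n ℂ :=
  if h : M.IsHermitian then
    (h.eigenvectorUnitary : Matrix n n ℂ) *
      Matrix.diagonal (fun i => (rpow0 (h.eigenvalues i) r : ℂ)) *
      star (h.eigenvectorUnitary : Matrix n n ℂ)
  else 0

/-- A density matrix: positive semidefinite with unit trace. -/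
def IsDensityMatrix (M : Matrix n n ℂ) : Prop := M.PosSemidef ∧ M.trace = 1

/-- Number of distinct eigenvalues of a Hermitian matrix (junk value `0` otherwise). -/
def nEig (M : Matrix n n ℂ) : ℕ :=
  if h : M.IsHermitian then (Finset.univ.image h.eigenvalues).card else 0

/-- The spectral projection of a Hermitian matrix onto the eigenspace of `t`. -/
def spectralProj (M : Matrix n n ℂ) (h : M.IsHermitian) (t : ℝ) : Matrix n n ℂ :=
  (h.eigenvectorUnitary : Matrix n n ℂ) *
    Matrix.diagonal (fun i => if h.eigenvalues i = t then (1 : ℂ) else 0) *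
    star (h.eigenvectorUnitary : Matrix n n ℂ)

/-- The pinching map with respect to a Hermitian matrix `A`:
`ℰ_A(B) = ∑_λ P_λ B P_λ` over the distinct eigenvalues `λ` of `A`. -/
def pinch (A B : Matrix n n ℂ) : Matrix n n ℂ :=
  if h : A.IsHermitian then
    ∑ t ∈ Finset.univ.image h.eigenvalues,
      spectralProj A h t * B * spectralProj A h t
  else B

/-- The spectral projection of a Hermitian matrix onto its nonnegative eigenvalues,
`Π = ∑_{λ ≥ 0} P_λ` (junk value `0` for non-Hermitian matrices). -/
def posProj (M : Matrix n n ℂ) : Matrix n n ℂ :=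
  if h : M.IsHermitian then
    (h.eigenvectorUnitary : Matrix n n ℂ) *
      Matrix.diagonal (fun i => if 0 ≤ h.eigenvalues i then (1 : ℂ) else 0) *
      star (h.eigenvectorUnitary : Matrix n n ℂ)
  else 0

/-- The sandwiched Rényi divergence
`D̃_α(ρ‖σ) = (1/(α−1)) log₂ Tr[(σ^{(1−α)/(2α)} ρ σ^{(1−α)/(2α)})^α]`. -/
def sandwichedRenyi (α : ℝ) (ρ σ : Matrix n n ℂ) : ℝ :=
  (1 / (α - 1)) *
    Real.logb 2
      ((matPow (matPow σ ((1 - α) / (2 * α)) * ρ * matPow σ ((1 - α) / (2 * α))) α).trace.re)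

/-- Fidelity `F(ρ,σ) = Tr[(σ^{1/2} ρ σ^{1/2})^{1/2}]`. -/
def fidelity (ρ σ : Matrix n n ℂ) : ℝ :=
  (matPow (matPow σ (1/2) * ρ * matPow σ (1/2)) (1/2)).trace.re

/-- Purified distance `P(ρ,σ) = √(1 − F(ρ,σ)²)`. -/
def purifiedDist (ρ σ : Matrix n n ℂ) : ℝ :=
  Real.sqrt (1 - (fidelity ρ σ) ^ 2)

/-- Base-two matrix logarithm by spectral functional calculus (`0 ↦ 0` on the kernel). -/
def matLog2 (M : Matrix n n ℂ) : Matrix n n ℂ :=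
  if h : M.IsHermitian then
    (h.eigenvectorUnitary : Matrix n n ℂ) *
      Matrix.diagonal (fun i => (Real.logb 2 (h.eigenvalues i) : ℂ)) *
      star (h.eigenvectorUnitary : Matrix n n ℂ)
  else 0

/-- Quantum relative entropy `D(ρ‖σ) = Tr[ρ (log₂ ρ − log₂ σ)]`. -/
def relEntropy (ρ σ : Matrix n n ℂ) : ℝ :=
  (ρ * (matLog2 ρ - matLog2 σ)).trace.re

end

open Module.End in
/-- Two commuting Hermitian matrices are diagonalized by a common unitary matrix. -/
theorem exists_unitary_diagonalizing_of_commute {n : Type*} [Fintype n] [DecidableEq n]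
    {A B : Matrix n n ℂ} (hA : A.IsHermitian) (hB : B.IsHermitian) (hAB : Commute A B) :
    ∃ V ∈ unitaryGroup n ℂ, ∃ a b : n → ℝ,
      A = V * diagonal (fun i => (a i : ℂ)) * star V ∧
      B = V * diagonal (fun i => (b i : ℂ)) * star V := by
  classical
  have sA := isSymmetric_toEuclideanLin_iff.mpr hA
  have sB := isSymmetric_toEuclideanLin_iff.mpr hB
  have hcomm : Commute (toEuclideanLin A) (toEuclideanLin B) := by
    ext x : 1
    simp only [Module.End.mul_apply, toLpLin_apply, mulVec_mulVec, hAB.eq]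
  have hinv : ∀ μ : ℂ, Set.MapsTo (toEuclideanLin B) (eigenspace (toEuclideanLin A) μ)
      (eigenspace (toEuclideanLin A) μ) := fun μ => mapsTo_genEigenspace_of_comm hcomm μ 1
  let fam := fun μ : Eigenvalues (toEuclideanLin A) =>
    (sB.restrict_invariant (hinv μ)).eigenvectorBasis rfl
  let c := sA.direct_sum_isInternal.collectedOrthonormalBasis sA.orthogonalFamily_eigenspaces' fam
  have hcard : Fintype.card (Σ μ : Eigenvalues (toEuclideanLin A),
      Fin (Module.finrank ℂ (eigenspace (toEuclideanLin A) (μ : ℂ)))) = Fintype.card n := by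
    rw [← Module.finrank_eq_card_basis c.toBasis, finrank_euclideanSpace]
  let e := Fintype.equivOfCardEq hcard
  have hcA : ∀ k, ∃ r : ℝ, toEuclideanLin A (c k) = (r : ℂ) • c k := by
    intro k
    obtain ⟨r, hr⟩ := Complex.conj_eq_iff_real.mp (sA.conj_eigenvalue_eq_self k.1.2)
    refine ⟨r, ?_⟩
    have h1 := sA.direct_sum_isInternal.collectedOrthonormalBasis_mem
      sA.orthogonalFamily_eigenspaces' fam k
    rw [← hr]
    exact mem_eigenspace_iff.mp h1
  have hcB : ∀ k, ∃ r : ℝ, toEuclideanLin B (c k) = (r : ℂ) • c k := by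
    intro k
    refine ⟨(sB.restrict_invariant (hinv k.1)).eigenvalues rfl k.2, ?_⟩
    have h1 := (sB.restrict_invariant (hinv k.1)).apply_eigenvectorBasis rfl k.2
    have h2 : c k = ((fam k.1 k.2 : eigenspace (toEuclideanLin A) (k.1 : ℂ)) :
        EuclideanSpace ℂ n) := by
      simp [c, DirectSum.IsInternal.collectedOrthonormalBasis]
    rw [h2]
    exact congrArg Subtype.val h1
  choose a ha using hcA
  choose b hb using hcB
  let V : Matrix n n ℂ := (EuclideanSpace.basisFun n ℂ).toBasis.toMatrix (c.reindex e)
  have hV : V ∈ unitaryGroup n ℂ :=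
    (EuclideanSpace.basisFun n ℂ).toMatrix_orthonormalBasis_mem_unitary (c.reindex e)
  have key : ∀ (M : Matrix n n ℂ) (d : _ → ℝ),
      (∀ k, toEuclideanLin M (c k) = (d k : ℂ) • c k) →
      M = V * diagonal (fun i => (d (e.symm i) : ℂ)) * star V := by
    intro M d hd
    have h1 : M * V = V * diagonal (fun i => (d (e.symm i) : ℂ)) := by
      ext i k
      have := congrArg (fun v : EuclideanSpace ℂ n => v i) (hd (e.symm k))
      simp only [toLpLin_apply, PiLp.smul_apply, smul_eq_mul] at this
      rw [mul_diagonal]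
      simpa [Matrix.mul_apply, mulVec, dotProduct, V, Module.Basis.toMatrix_apply, mul_comm] using this
    rw [← h1, Matrix.mul_assoc, mem_unitaryGroup_iff.mp hV, Matrix.mul_one]
  exact ⟨V, hV, fun i => a (e.symm i), fun i => b (e.symm i), key A a ha, key B b hb⟩

/-- The functional calculus does not depend on the chosen diagonalization. -/
theorem diagonalization_map_eq {n : Type*} [Fintype n] [DecidableEq n]
    {V W : Matrix n n ℂ} (hV : V ∈ unitaryGroup n ℂ) (hW : W ∈ unitaryGroup n ℂ) {d e : n → ℝ}
    (h : W * diagonal (fun i => (e i : ℂ)) * star W = V * diagonal (fun i => (d i : ℂ)) * star V)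
    (f : ℝ → ℂ) :
    W * diagonal (fun i => f (e i)) * star W = V * diagonal (fun i => f (d i)) * star V := by
  have hV' := mem_unitaryGroup_iff'.mp hV
  have hW' := mem_unitaryGroup_iff'.mp hW
  have h1 : star V * W * diagonal (fun i => (e i : ℂ)) =
      diagonal (fun i => (d i : ℂ)) * (star V * W) := by
    calc _ = star V * (W * diagonal (fun i => (e i : ℂ)) * star W) * W := by
          simp only [Matrix.mul_assoc, hW', Matrix.mul_one]
      _ = (star V * V) * diagonal (fun i => (d i : ℂ)) * (star V * W) := by
          rw [h]; simp only [Matrix.mul_assoc]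
      _ = _ := by rw [hV', Matrix.one_mul]
  have h2 : star V * W * diagonal (fun i => f (e i)) =
      diagonal (fun i => f (d i)) * (star V * W) := by
    ext k l
    have h3 := congrFun (congrFun h1 k) l
    rw [mul_diagonal, diagonal_mul] at h3 ⊢
    by_cases h0 : (star V * W) k l = 0
    · simp [h0]
    · have h4 : (e l : ℂ) = d k := mul_left_cancel₀ h0 (h3.trans (mul_comm _ _))
      rw [Complex.ofReal_inj.mp h4, mul_comm]
  calc W * diagonal (fun i => f (e i)) * star W
      = (V * star V) * W * diagonal (fun i => f (e i)) * star W := by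
        rw [mem_unitaryGroup_iff.mp hV, Matrix.one_mul]
    _ = V * (star V * W * diagonal (fun i => f (e i))) * star W := by
        simp only [Matrix.mul_assoc]
    _ = V * diagonal (fun i => f (d i)) * star V * (W * star W) := by
        rw [h2]; simp only [Matrix.mul_assoc]
    _ = _ := by rw [mem_unitaryGroup_iff.mp hW, Matrix.mul_one]

theorem isHermitian_unitary_conj_diagonal {n : Type*} [Fintype n] [DecidableEq n]
    (V : Matrix n n ℂ) (d : n → ℝ) :
    (V * diagonal (fun i => (d i : ℂ)) * star V).IsHermitian :=
  isHermitian_mul_mul_conjTranspose V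
    (isHermitian_diagonal_of_self_adjoint _ (funext fun i => by simp))

theorem eigenvectorUnitary_conj_diagonal {n : Type*} [Fintype n] [DecidableEq n]
    {M : Matrix n n ℂ} (h : M.IsHermitian) :
    (h.eigenvectorUnitary : Matrix n n ℂ) * diagonal (fun i => (h.eigenvalues i : ℂ)) *
      star (h.eigenvectorUnitary : Matrix n n ℂ) = M :=
  h.spectral_theorem.symm

theorem matPow_unitary_conj_diagonal {n : Type*} [Fintype n] [DecidableEq n]
    {V : Matrix n n ℂ} (hV : V ∈ unitaryGroup n ℂ) (d : n → ℝ) (r : ℝ) :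
    matPow (V * diagonal (fun i => (d i : ℂ)) * star V) r =
      V * diagonal (fun i => (rpow0 (d i) r : ℂ)) * star V := by
  have h := isHermitian_unitary_conj_diagonal V d
  rw [matPow, dif_pos h]
  exact diagonalization_map_eq hV h.eigenvectorUnitary.2
    (eigenvectorUnitary_conj_diagonal h) fun x => (rpow0 x r : ℂ)

theorem spectralProj_eq_of_diagonalization {n : Type*} [Fintype n] [DecidableEq n]
    {M V : Matrix n n ℂ} (hV : V ∈ unitaryGroup n ℂ) {d : n → ℝ} (h : M.IsHermitian)
    (hM : M = V * diagonal (fun i => (d i : ℂ)) * star V) (t : ℝ) :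
    spectralProj M h t = V * diagonal (fun i => if d i = t then (1 : ℂ) else 0) * star V :=
  diagonalization_map_eq hV h.eigenvectorUnitary.2
    ((eigenvectorUnitary_conj_diagonal h).trans hM) fun x => if x = t then (1 : ℂ) else 0

theorem rpow0_eq_rpow (x : ℝ) {r : ℝ} (hr : r ≠ 0) : rpow0 x r = x ^ r := by
  unfold rpow0
  split_ifs with h
  · rw [h, Real.zero_rpow hr]
  · rfl

theorem trace_matPow {n : Type*} [Fintype n] [DecidableEq n] {M : Matrix n n ℂ}
    (h : M.IsHermitian) (r : ℝ) :
    (matPow M r).trace.re = ∑ i, rpow0 (h.eigenvalues i) r := by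
  rw [matPow, dif_pos h, trace_mul_cycle, mem_unitaryGroup_iff'.mp h.eigenvectorUnitary.2,
    Matrix.one_mul, trace_diagonal]
  simp

/-- A Bessel-type inequality for the normalized images of the standard basis vectors in a block on
which `U * diagonal x * star U` is diagonal. -/
theorem sum_filter_weight_le_one {n : Type*} [Fintype n] [DecidableEq n]
    {U : Matrix n n ℂ} {x : n → ℝ} (hx : ∀ j, 0 ≤ x j) (T : Finset n)
    (hT : ∀ k ∈ T, ∀ k' ∈ T, k ≠ k' → (U * diagonal (fun i => (x i : ℂ)) * star U) k k' = 0)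
    {y : n → ℝ} (hy0 : ∀ k, 0 ≤ y k)
    (hy : ∀ k, (U * diagonal (fun i => (x i : ℂ)) * star U) k k = y k) (j : n) :
    ∑ k ∈ T, x j * Complex.normSq (U k j) / y k ≤ 1 := by
  set B : ℝ := ∑ k ∈ T, Complex.normSq (U k j) / y k with hB
  have hB0 : 0 ≤ B :=
    Finset.sum_nonneg fun k _ => div_nonneg (Complex.normSq_nonneg _) (hy0 k)
  let v : n → ℂ := fun k => if k ∈ T then U k j / y k else 0
  have hv : ∀ k ∉ T, v k = 0 := fun k hk => if_neg hk
  have hquad : star v ⬝ᵥ ((U * diagonal (fun i => (x i : ℂ)) * star U) *ᵥ v) = (B : ℂ) := by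
    have h1 : ∀ k ∈ T, star v k * ((U * diagonal (fun i => (x i : ℂ)) * star U) *ᵥ v) k =
        ((Complex.normSq (U k j) / y k : ℝ) : ℂ) := by
      intro k hk
      have h2 : ((U * diagonal (fun i => (x i : ℂ)) * star U) *ᵥ v) k = y k * v k := by
        rw [mulVec, dotProduct, Finset.sum_eq_single k, hy]
        · intro k' _ hne
          by_cases hk' : k' ∈ T
          · rw [hT k hk k' hk' hne.symm, zero_mul]
          · rw [hv k' hk', mul_zero]
        · simp
      rw [h2]
      simp only [v, hk, if_true, Pi.star_apply, star_div₀, Complex.star_def, Complex.conj_ofReal]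
      rcases eq_or_ne (y k) 0 with h0 | h0
      · simp [h0]
      · have h0' : (y k : ℂ) ≠ 0 := Complex.ofReal_ne_zero.mpr h0
        push_cast
        rw [Complex.normSq_eq_conj_mul_self]
        field_simp
    rw [dotProduct, ← Finset.sum_subset (Finset.subset_univ T)
      (fun k _ hk => by simp [hv k hk]), Finset.sum_congr rfl h1, hB]
    push_cast; rfl
  have hdiag : star v ⬝ᵥ ((U * diagonal (fun i => (x i : ℂ)) * star U) *ᵥ v) =
      ((∑ i, x i * Complex.normSq ((star U *ᵥ v) i) : ℝ) : ℂ) := by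
    have h1 : star v ᵥ* U = star (star U *ᵥ v) := by
      rw [star_mulVec, star_eq_conjTranspose, conjTranspose_conjTranspose]
    rw [← mulVec_mulVec, ← mulVec_mulVec, dotProduct_mulVec, h1, dotProduct]
    push_cast
    refine Finset.sum_congr rfl fun i _ => ?_
    rw [mulVec_diagonal, Pi.star_apply, Complex.normSq_eq_conj_mul_self, Complex.star_def]
    ring
  have hcoef : (star U *ᵥ v) j = (B : ℂ) := by
    rw [mulVec, dotProduct, ← Finset.sum_subset (Finset.subset_univ T)
      (fun k _ hk => by simp [hv k hk]), hB]
    push_cast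
    refine Finset.sum_congr rfl fun k hk => ?_
    simp only [v, hk, if_true, star_apply, Complex.star_def]
    rw [Complex.normSq_eq_conj_mul_self, mul_div_assoc]
  have hle : x j * (B * B) ≤ B := by
    have h1 : B = ∑ i, x i * Complex.normSq ((star U *ᵥ v) i) := by
      exact_mod_cast hquad.symm.trans hdiag
    calc x j * (B * B) = x j * Complex.normSq ((star U *ᵥ v) j) := by
          rw [hcoef, Complex.normSq_ofReal]
      _ ≤ ∑ i, x i * Complex.normSq ((star U *ᵥ v) i) :=
          Finset.single_le_sum (f := fun i => x i * Complex.normSq ((star U *ᵥ v) i))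
            (fun i _ => mul_nonneg (hx i) (Complex.normSq_nonneg _)) (Finset.mem_univ j)
      _ = B := h1.symm
  have hsum : ∑ k ∈ T, x j * Complex.normSq (U k j) / y k = x j * B := by
    rw [hB, Finset.mul_sum]
    exact Finset.sum_congr rfl fun k _ => mul_div_assoc _ _ _
  rw [hsum]
  rcases hB0.eq_or_lt with h0 | h0
  · simp [← h0]
  · exact le_of_mul_le_mul_right (by linarith) h0

/-- If a positive semidefinite matrix with eigenvalues `x` is diagonal within each block of a
partition into at most `S.card` blocks, then the `s`-th powers of its diagonal entries sum to at
most `S.card ^ (1 - s)` times those of its eigenvalues. -/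
theorem sum_diag_rpow_le {n ι : Type*} [Fintype n] [DecidableEq n] [DecidableEq ι]
    {U : Matrix n n ℂ} (hU : U ∈ unitaryGroup n ℂ) {x : n → ℝ} (hx : ∀ j, 0 ≤ x j)
    (l : n → ι) (S : Finset ι) (hS : ∀ k, l k ∈ S)
    (hZ : ∀ k k', k ≠ k' → l k = l k' →
      (U * diagonal (fun i => (x i : ℂ)) * star U) k k' = 0)
    {y : n → ℝ} (hy : ∀ k, (U * diagonal (fun i => (x i : ℂ)) * star U) k k = y k)
    {s : ℝ} (hs0 : 0 < s) (hs1 : s ≤ 1) :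
    ∑ k, y k ^ s ≤ (S.card : ℝ) ^ (1 - s) * ∑ j, x j ^ s := by
  have hy' : ∀ k, y k = ∑ j, x j * Complex.normSq (U k j) := by
    intro k
    have h := hy k
    rw [Matrix.mul_apply] at h
    have h2 : (y k : ℂ) = ((∑ j, x j * Complex.normSq (U k j) : ℝ) : ℂ) := by
      rw [← h]
      push_cast
      refine Finset.sum_congr rfl fun j _ => ?_
      rw [mul_diagonal, star_apply, Complex.normSq_eq_conj_mul_self, Complex.star_def]
      ring
    exact_mod_cast h2
  have hterm : ∀ k j, 0 ≤ x j * Complex.normSq (U k j) :=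
    fun k j => mul_nonneg (hx j) (Complex.normSq_nonneg _)
  have hy0 : ∀ k, 0 ≤ y k := fun k => hy' k ▸ Finset.sum_nonneg fun j _ => hterm k j
  let w : n → n → ℝ := fun j k => x j * Complex.normSq (U k j) / y k
  have hw0 : ∀ j k, 0 ≤ w j k := fun j k => div_nonneg (hterm k j) (hy0 k)
  have hwy : ∀ j k, w j k * y k = x j * Complex.normSq (U k j) := by
    intro j k
    rcases eq_or_ne (y k) 0 with h0 | h0
    · have h1 := (Finset.sum_eq_zero_iff_of_nonneg fun j _ => hterm k j).mp
        ((hy' k).symm.trans h0) j (Finset.mem_univ j)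
      rw [h0, h1, mul_zero]
    · exact div_mul_cancel₀ _ h0
  have hws : ∀ k, ∑ j, w j k * y k ^ s = y k ^ s := by
    intro k
    rcases eq_or_ne (y k) 0 with h0 | h0
    · simp [h0, Real.zero_rpow hs0.ne']
    · rw [← Finset.sum_mul, ← Finset.sum_div, ← hy' k, div_self h0, one_mul]
  have hwS : ∀ j, ∑ k, w j k ≤ S.card := by
    intro j
    rw [← Finset.sum_fiberwise_of_maps_to (s := Finset.univ) (t := S) (g := l)
      (fun k _ => hS k) (fun k => w j k)]
    calc _ ≤ ∑ _t ∈ S, (1 : ℝ) := Finset.sum_le_sum fun t _ =>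
          sum_filter_weight_le_one hx _ (fun k hk k' hk' hne => hZ k k' hne (by
            rw [(Finset.mem_filter.mp hk).2, (Finset.mem_filter.mp hk').2])) hy0 hy j
      _ = S.card := by simp
  have hcol : ∀ j, ∑ k, Complex.normSq (U k j) = 1 := by
    intro j
    have h := congrFun (congrFun (mem_unitaryGroup_iff'.mp hU) j) j
    rw [Matrix.mul_apply, one_apply_eq] at h
    have h2 : ((∑ k, Complex.normSq (U k j) : ℝ) : ℂ) = 1 := by
      rw [← h]
      push_cast
      refine Finset.sum_congr rfl fun k _ => ?_
      rw [star_apply, Complex.normSq_eq_conj_mul_self, Complex.star_def]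
    exact_mod_cast h2
  have hj : ∀ j, ∑ k, w j k * y k ^ s ≤ (S.card : ℝ) ^ (1 - s) * x j ^ s := by
    intro j
    have h := Real.inner_le_weight_mul_Lp_of_nonneg Finset.univ (p := s⁻¹)
      (one_le_inv₀ hs0 |>.mpr hs1) (w j) (fun k => y k ^ s) (hw0 j)
      (fun k => Real.rpow_nonneg (hy0 k) s)
    have h2 : ∑ k, w j k * (y k ^ s) ^ s⁻¹ = x j := by
      calc _ = ∑ k, x j * Complex.normSq (U k j) :=
            Finset.sum_congr rfl fun k _ => by
              rw [Real.rpow_rpow_inv (hy0 k) hs0.ne', hwy]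
        _ = x j := by rw [← Finset.mul_sum, hcol, mul_one]
    rw [h2, inv_inv] at h
    refine h.trans ?_
    gcongr
    · exact Real.rpow_nonneg (hx j) s
    · exact Finset.sum_nonneg fun k _ => hw0 j k
    · exact hwS j
  calc ∑ k, y k ^ s = ∑ k, ∑ j, w j k * y k ^ s := Finset.sum_congr rfl fun k _ => (hws k).symm
    _ = ∑ j, ∑ k, w j k * y k ^ s := Finset.sum_comm
    _ ≤ ∑ j, (S.card : ℝ) ^ (1 - s) * x j ^ s := Finset.sum_le_sum fun j _ => hj j
    _ = _ := by rw [Finset.mul_sum]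

theorem isHermitian_spectralProj {n : Type*} [Fintype n] [DecidableEq n] {M : Matrix n n ℂ}
    (h : M.IsHermitian) (t : ℝ) : (spectralProj M h t).IsHermitian :=
  isHermitian_mul_mul_conjTranspose _
    (isHermitian_diagonal_of_self_adjoint _ (funext fun i => by simp [apply_ite]))

theorem unitary_conj_mul_unitary_conj {n : Type*} [Fintype n] [DecidableEq n]
    {V : Matrix n n ℂ} (hV : V ∈ unitaryGroup n ℂ) (A B : Matrix n n ℂ) :
    (V * A * star V) * (V * B * star V) = V * (A * B) * star V := by
  calc _ = V * A * (star V * V) * B * star V := by simp only [Matrix.mul_assoc]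
    _ = _ := by rw [mem_unitaryGroup_iff'.mp hV, Matrix.mul_one]; simp only [Matrix.mul_assoc]

theorem star_mul_unitary_conj_mul {n : Type*} [Fintype n] [DecidableEq n]
    {V : Matrix n n ℂ} (hV : V ∈ unitaryGroup n ℂ) (A : Matrix n n ℂ) :
    star V * (V * A * star V) * V = A := by
  calc _ = (star V * V) * A * (star V * V) := by simp only [Matrix.mul_assoc]
    _ = A := by rw [mem_unitaryGroup_iff'.mp hV, Matrix.mul_one, Matrix.one_mul]

theorem unitary_conj_star_mul_mul {n : Type*} [Fintype n] [DecidableEq n]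
    {V : Matrix n n ℂ} (hV : V ∈ unitaryGroup n ℂ) (A : Matrix n n ℂ) :
    V * (star V * A * V) * star V = A := by
  calc _ = (V * star V) * A * (V * star V) := by simp only [Matrix.mul_assoc]
    _ = A := by rw [mem_unitaryGroup_iff.mp hV, Matrix.mul_one, Matrix.one_mul]

theorem mul_spectralProj {n : Type*} [Fintype n] [DecidableEq n] {M : Matrix n n ℂ}
    (h : M.IsHermitian) (t : ℝ) : M * spectralProj M h t = (t : ℂ) • spectralProj M h t := by
  have h1 := unitary_conj_mul_unitary_conj h.eigenvectorUnitary.2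
    (diagonal fun i => (h.eigenvalues i : ℂ))
    (diagonal fun i => if h.eigenvalues i = t then (1 : ℂ) else 0)
  rw [eigenvectorUnitary_conj_diagonal h] at h1
  refine h1.trans ?_
  have h2 : diagonal (fun i => (h.eigenvalues i : ℂ)) *
      diagonal (fun i => if h.eigenvalues i = t then (1 : ℂ) else 0) =
      (t : ℂ) • diagonal (fun i => if h.eigenvalues i = t then (1 : ℂ) else 0) := by
    rw [diagonal_mul_diagonal, ← diagonal_smul]
    congr 1
    funext i
    by_cases hi : h.eigenvalues i = t <;> simp [hi]
  rw [h2, Matrix.mul_smul, Matrix.smul_mul, spectralProj]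

theorem spectralProj_mul {n : Type*} [Fintype n] [DecidableEq n] {M : Matrix n n ℂ}
    (h : M.IsHermitian) (t : ℝ) : spectralProj M h t * M = (t : ℂ) • spectralProj M h t := by
  have h1 := congrArg conjTranspose (mul_spectralProj h t)
  rw [conjTranspose_mul, conjTranspose_smul, (isHermitian_spectralProj h t).eq, h.eq] at h1
  simpa using h1

theorem isHermitian_pinch {n : Type*} [Fintype n] [DecidableEq n] {A B : Matrix n n ℂ}
    (hA : A.IsHermitian) (hB : B.IsHermitian) : (pinch A B).IsHermitian := by
  rw [pinch, dif_pos hA, IsHermitian, conjTranspose_sum]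
  refine Finset.sum_congr rfl fun t _ => ?_
  rw [conjTranspose_mul, conjTranspose_mul, (isHermitian_spectralProj hA t).eq, hB.eq,
    Matrix.mul_assoc]

theorem commute_pinch {n : Type*} [Fintype n] [DecidableEq n] {A : Matrix n n ℂ}
    (hA : A.IsHermitian) (B : Matrix n n ℂ) : Commute A (pinch A B) := by
  rw [pinch, dif_pos hA]
  refine Commute.sum_right _ _ _ fun t _ => ?_
  rw [Commute, SemiconjBy, ← Matrix.mul_assoc, ← Matrix.mul_assoc, mul_spectralProj,
    Matrix.mul_assoc _ _ A, spectralProj_mul]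
  simp

theorem mem_image_eigenvalues_of_diagonalization {n : Type*} [Fintype n] [DecidableEq n]
    {M V : Matrix n n ℂ} (hV : V ∈ unitaryGroup n ℂ) {d : n → ℝ} (h : M.IsHermitian)
    (hM : M = V * diagonal (fun i => (d i : ℂ)) * star V) (k : n) :
    d k ∈ Finset.univ.image h.eigenvalues := by
  by_contra hk
  have h0 : spectralProj M h (d k) = 0 := by
    have h1 : ∀ i, h.eigenvalues i ≠ d k := fun i hi =>
      hk (Finset.mem_image.mpr ⟨i, Finset.mem_univ i, hi⟩)
    simp [spectralProj, h1]
  rw [spectralProj_eq_of_diagonalization hV h hM] at h0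
  have h2 := star_mul_unitary_conj_mul hV (diagonal fun i => if d i = d k then (1 : ℂ) else 0)
  rw [h0] at h2
  simpa using congrFun (congrFun h2 k) k

/-- In a basis diagonalizing `A`, pinching deletes the entries between different eigenvalues. -/
theorem star_mul_pinch_mul_apply {n : Type*} [Fintype n] [DecidableEq n]
    {A V : Matrix n n ℂ} (hV : V ∈ unitaryGroup n ℂ) {d : n → ℝ} (hA : A.IsHermitian)
    (hAV : A = V * diagonal (fun i => (d i : ℂ)) * star V) (B : Matrix n n ℂ) (k k' : n) :
    (star V * pinch A B * V) k k' = if d k = d k' then (star V * B * V) k k' else 0 := by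
  have h1 : ∀ t, star V * (spectralProj A hA t * B * spectralProj A hA t) * V =
      diagonal (fun i => if d i = t then (1 : ℂ) else 0) * (star V * B * V) *
        diagonal (fun i => if d i = t then (1 : ℂ) else 0) := by
    intro t
    conv_lhs => rw [← unitary_conj_star_mul_mul hV B]
    rw [spectralProj_eq_of_diagonalization hV hA hAV, unitary_conj_mul_unitary_conj hV,
      unitary_conj_mul_unitary_conj hV, star_mul_unitary_conj_mul hV]
  rw [pinch, dif_pos hA, Matrix.mul_sum, Matrix.sum_mul, Matrix.sum_apply]
  simp only [h1, mul_diagonal, diagonal_mul]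
  rw [Finset.sum_eq_single (d k)]
  · by_cases h : d k = d k'
    · simp [h]
    · simp [h, Ne.symm h]
  · intro t _ ht
    simp [ht.symm]
  · exact fun h => absurd (mem_image_eigenvalues_of_diagonalization hV hA hAV k) h

/-- STATEMENT 12: pinching–divergence bound:
`Tr[ℰ_σ(ρ)^{1−α} σ^α] ≤ ν_σ^α · Tr[(σ^{α/(2(1−α))} ρ σ^{α/(2(1−α))})^{1−α}]`,
i.e. `Tr[ℰ_σ(ρ)^{1−α} σ^α] ≤ ν_σ^α · 2^{−α D̃_{1−α}(ρ‖σ)}`. -/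
theorem pinching_divergence_bound
    {n : Type*} [Fintype n] [DecidableEq n]
    (ρ σ : Matrix n n ℂ) (hρ : IsDensityMatrix ρ) (hσ : IsDensityMatrix σ)
    (α : ℝ) (hα : α ∈ Set.Ioo (0 : ℝ) (1/2)) :
    (matPow (pinch σ ρ) (1 - α) * matPow σ α).trace.re ≤
      (nEig σ : ℝ) ^ α *
        (matPow (matPow σ (α / (2 * (1 - α))) * ρ *
          matPow σ (α / (2 * (1 - α)))) (1 - α)).trace.re := by
  obtain ⟨hα0, hα1⟩ := hα
  have hs0 : 0 < 1 - α := by linarith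
  have hσH := hσ.1.isHermitian
  have hρH := hρ.1.isHermitian
  obtain ⟨V, hV, l, m, hl, hm⟩ := exists_unitary_diagonalizing_of_commute hσH
    (isHermitian_pinch hσH hρH) (commute_pinch hσH ρ)
  have hR : (star V * ρ * V).PosSemidef := hρ.1.conjTranspose_mul_mul_same V
  have hblock : ∀ k k', diagonal (fun i => (m i : ℂ)) k k' =
      if l k = l k' then (star V * ρ * V) k k' else 0 := fun k k' => by
    rw [← star_mul_pinch_mul_apply hV hσH hl, hm, star_mul_unitary_conj_mul hV]
  have hRdiag : ∀ k, (star V * ρ * V) k k = m k := fun k => by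
    simpa using (hblock k k).symm
  have hm0 : ∀ k, 0 ≤ m k := fun k => by
    have h := hR.diag_nonneg (i := k)
    rw [hRdiag] at h
    exact_mod_cast h
  have hl0 : ∀ k, 0 ≤ l k := fun k => by
    have h := (hσ.1.conjTranspose_mul_mul_same V).diag_nonneg (i := k)
    rw [hl, ← star_eq_conjTranspose, star_mul_unitary_conj_mul hV, diagonal_apply_eq] at h
    exact_mod_cast h
  set q : ℝ := α / (2 * (1 - α)) with hq
  have hq0 : 0 < q := by positivity
  have hσq : matPow σ q = V * diagonal (fun i => (rpow0 (l i) q : ℂ)) * star V := by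
    conv_lhs => rw [hl]
    exact matPow_unitary_conj_diagonal hV l q
  have hX : (matPow σ q * ρ * matPow σ q).PosSemidef := by
    have h : (matPow σ q).IsHermitian := hσq ▸ isHermitian_unitary_conj_diagonal V _
    simpa only [h.eq] using hρ.1.mul_mul_conjTranspose_same (matPow σ q)
  let D : Matrix n n ℂ := diagonal (fun i => (rpow0 (l i) q : ℂ))
  have hXV : star V * (matPow σ q * ρ * matPow σ q) * V = D * (star V * ρ * V) * D := by
    conv_lhs => rw [← unitary_conj_star_mul_mul hV ρ]
    rw [hσq, unitary_conj_mul_unitary_conj hV, unitary_conj_mul_unitary_conj hV,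
      star_mul_unitary_conj_mul hV]
  let W := hX.isHermitian.eigenvectorUnitary
  have hU : star V * (W : Matrix n n ℂ) ∈ unitaryGroup n ℂ :=
    mul_mem (Unitary.star_mem hV) W.2
  have hZ : star V * (W : Matrix n n ℂ) *
      diagonal (fun i => (hX.isHermitian.eigenvalues i : ℂ)) *
      star (star V * (W : Matrix n n ℂ)) = D * (star V * ρ * V) * D := by
    rw [← hXV, star_mul, star_star]
    conv_rhs => rw [← eigenvectorUnitary_conj_diagonal hX.isHermitian]
    simp only [W, Matrix.mul_assoc]
  have hmain := sum_diag_rpow_le (y := fun k => m k * (l k ^ q * l k ^ q)) (s := 1 - α)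
    hU hX.eigenvalues_nonneg l
    (Finset.univ.image hσH.eigenvalues)
    (mem_image_eigenvalues_of_diagonalization hV hσH hl)
    (fun k k' hne hlk => by
      have h := hblock k k'
      rw [diagonal_apply_ne _ hne, if_pos hlk] at h
      rw [hZ, mul_diagonal, diagonal_mul, ← h, mul_zero, zero_mul])
    (fun k => by
      rw [hZ, mul_diagonal, diagonal_mul, hRdiag, rpow0_eq_rpow _ hq0.ne']
      push_cast
      ring) hs0 (by linarith)
  have hlhs : (matPow (pinch σ ρ) (1 - α) * matPow σ α).trace.re =
      ∑ k, (m k * (l k ^ q * l k ^ q)) ^ (1 - α) := by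
    have h1 : matPow σ α = V * diagonal (fun i => (rpow0 (l i) α : ℂ)) * star V := by
      conv_lhs => rw [hl]
      exact matPow_unitary_conj_diagonal hV l α
    rw [h1, hm, matPow_unitary_conj_diagonal hV, unitary_conj_mul_unitary_conj hV,
      trace_mul_cycle, mem_unitaryGroup_iff'.mp hV, Matrix.one_mul, diagonal_mul_diagonal,
      trace_diagonal, Complex.re_sum]
    refine Finset.sum_congr rfl fun k _ => ?_
    have hexp : q * (1 - α) + q * (1 - α) = α := by
      rw [hq]
      field_simp
      ring
    rw [rpow0_eq_rpow _ hs0.ne', rpow0_eq_rpow _ hα0.ne', ← Complex.ofReal_mul,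
      Complex.ofReal_re, Real.mul_rpow (hm0 k) (by have := hl0 k; positivity),
      Real.mul_rpow (Real.rpow_nonneg (hl0 k) q) (Real.rpow_nonneg (hl0 k) q),
      ← Real.rpow_mul (hl0 k), ← Real.rpow_add_of_nonneg (hl0 k) (by positivity) (by positivity),
      hexp]
  rw [hlhs, trace_matPow hX.isHermitian, nEig, dif_pos hσH]
  simpa only [sub_sub_cancel, rpow0_eq_rpow _ hs0.ne'] using hmain
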